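/- Let M > 0, Λ ∈ ℝ, and Δ(r) = r(r−2M). Suppose φ and G are complex-valued functions on ℝ × (2M,∞), with φ twice continuously differentiable and G continuous, satisfying (r⁴/Δ)∂²_t φ − ∂_r(Δ ∂_r φ) + Λφ − (8M/r)φ + G = 0 pointwise. Set f̂(r) = (r−2M)(r−3M)/(3r²), q̂(r) = (2r−3M)Δ/(6r⁴), and X(φ) = f̂ ∂_rφ + q̂ φ. Then at every point of ℝ × (2M,∞): ∂_t[ Re( (r⁴/Δ) X(φ) · conj(∂_tφ) ) ] + (1/2)∂_r[ f̂·( Λ|φ|² − (r⁴/Δ)|∂_tφ|² − Δ|∂_rφ|² − (8M/r)|φ|² ) ] + (1/2)∂_r[ ∂_r(Δq̂)·|φ|² − 2Δq̂·Re(conj(φ)∂_rφ) − 2q̂(r−M)|φ|² ] + (MΔ²/r⁴)|∂_rφ|² + ( −(5/2)M/r² + 15M²/r³ − 23M³/r⁴ )|φ|² + ((r−3M)²/(3r³))·Λ|φ|² = −Re( X(φ) · conj(G) ). -/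

import Mathlib

/-- The Morawetz multiplier weight `f̂(r) = (r−2M)(r−3M)/(3r²)`. -/
noncomputable def fhat (M r : ℝ) : ℝ := (r - 2 * M) * (r - 3 * M) / (3 * r ^ 2)

/-- The Morawetz multiplier weight `q̂(r) = (2r−3M)Δ/(6r⁴)` with `Δ = r(r−2M)`. -/
noncomputable def qhat (M r : ℝ) : ℝ :=
  (2 * r - 3 * M) * (r * (r - 2 * M)) / (6 * r ^ 4)

/-- The Morawetz multiplier `X(φ) = f̂ ∂_rφ + q̂ φ`. -/
noncomputable def Xmult (M : ℝ) (φ : ℝ → ℝ → ℂ) (t r : ℝ) : ℂ :=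
  ((fhat M r : ℝ) : ℂ) * deriv (fun x => φ t x) r + ((qhat M r : ℝ) : ℂ) * φ t r

theorem exists_hasDerivAt_partials {E : Type*} [NormedAddCommGroup E] [NormedSpace ℝ E]
    {φ : ℝ → ℝ → E} {U : Set (ℝ × ℝ)} (hU : IsOpen U)
    (hφ : ContDiffOn ℝ 2 (fun p : ℝ × ℝ => φ p.1 p.2) U) {t r : ℝ} (h : (t, r) ∈ U) :
    ∃ A B C : E,
      HasDerivAt (fun s => φ s r) (deriv (fun s => φ s r) t) t ∧
      HasDerivAt (fun x => φ t x) (deriv (fun x => φ t x) r) r ∧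
      HasDerivAt (fun s => deriv (fun s' => φ s' r) s) A t ∧
      HasDerivAt (fun s => deriv (fun x => φ s x) r) B t ∧
      HasDerivAt (fun x => deriv (fun s => φ s x) t) B r ∧
      HasDerivAt (fun x => deriv (fun x' => φ t x') x) C r := by
  set F : ℝ × ℝ → E := fun p => φ p.1 p.2
  have inl : ∀ s x : ℝ, HasDerivAt (fun s' : ℝ => (s', x)) ((1, 0) : ℝ × ℝ) s := fun s x =>
    (hasDerivAt_id s).prodMk (hasDerivAt_const s x)
  have inr : ∀ s x : ℝ, HasDerivAt (fun x' : ℝ => (s, x')) ((0, 1) : ℝ × ℝ) x := fun s x =>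
    (hasDerivAt_const x s).prodMk (hasDerivAt_id x)
  have hd : ∀ p ∈ U, HasFDerivAt F (fderiv ℝ F p) p := fun p hp =>
    ((hφ.contDiffAt (hU.mem_nhds hp)).differentiableAt (by norm_num)).hasFDerivAt
  have dt : ∀ s x, (s, x) ∈ U → HasDerivAt (fun s' => φ s' x) (fderiv ℝ F (s, x) (1, 0)) s :=
    fun s x hp => HasFDerivAt.comp_hasDerivAt (l := F) s (hd (s, x) hp) (inl s x)
  have dr : ∀ s x, (s, x) ∈ U → HasDerivAt (fun x' => φ s x') (fderiv ℝ F (s, x) (0, 1)) x :=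
    fun s x hp => HasFDerivAt.comp_hasDerivAt (l := F) x (hd (s, x) hp) (inr s x)
  have hc : ContDiffAt ℝ 2 F (t, r) := hφ.contDiffAt (hU.mem_nhds h)
  have hdd : HasFDerivAt (fderiv ℝ F) (fderiv ℝ (fderiv ℝ F) (t, r)) (t, r) :=
    ((hc.fderiv_right (m := 1) (by norm_num)).differentiableAt (by norm_num)).hasFDerivAt
  have hsymm : fderiv ℝ (fderiv ℝ F) (t, r) (1, 0) (0, 1) =
      fderiv ℝ (fderiv ℝ F) (t, r) (0, 1) (1, 0) :=
    hc.isSymmSndFDerivAt (by simp) _ _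
  have ddt : ∀ v, HasDerivAt (fun s => fderiv ℝ F (s, r) v)
      (fderiv ℝ (fderiv ℝ F) (t, r) (1, 0) v) t := fun v =>
    (ContinuousLinearMap.apply ℝ E v).hasFDerivAt.comp_hasDerivAt t (hdd.comp_hasDerivAt t (inl t r))
  have ddr : ∀ v, HasDerivAt (fun x => fderiv ℝ F (t, x) v)
      (fderiv ℝ (fderiv ℝ F) (t, r) (0, 1) v) r := fun v =>
    (ContinuousLinearMap.apply ℝ E v).hasFDerivAt.comp_hasDerivAt r (hdd.comp_hasDerivAt r (inr t r))
  have evt : ∀ᶠ s in nhds t, (s, r) ∈ U := (inl t r).continuousAt.eventually (hU.mem_nhds h)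
  have evr : ∀ᶠ x in nhds r, (t, x) ∈ U := (inr t r).continuousAt.eventually (hU.mem_nhds h)
  refine ⟨fderiv ℝ (fderiv ℝ F) (t, r) (1, 0) (1, 0), fderiv ℝ (fderiv ℝ F) (t, r) (1, 0) (0, 1),
    fderiv ℝ (fderiv ℝ F) (t, r) (0, 1) (0, 1), (dt t r h).differentiableAt.hasDerivAt,
    (dr t r h).differentiableAt.hasDerivAt, ?_, ?_, ?_, ?_⟩
  · exact (ddt _).congr_of_eventuallyEq (evt.mono fun s hs => (dt s r hs).deriv)
  · exact (ddt _).congr_of_eventuallyEq (evt.mono fun s hs => (dr s r hs).deriv)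
  · rw [hsymm]
    exact (ddr _).congr_of_eventuallyEq (evr.mono fun x hx => (dt t x hx).deriv)
  · exact (ddr _).congr_of_eventuallyEq (evr.mono fun x hx => (dr t x hx).deriv)

theorem HasDerivAt.complex_re {f : ℝ → ℂ} {f' : ℂ} {x : ℝ} (h : HasDerivAt f f' x) :
    HasDerivAt (fun y => (f y).re) f'.re x :=
  Complex.reCLM.hasFDerivAt.comp_hasDerivAt x h

theorem HasDerivAt.complex_norm_sq {f : ℝ → ℂ} {f' : ℂ} {x : ℝ} (h : HasDerivAt f f' x) :
    HasDerivAt (fun y => ‖f y‖ ^ 2) (2 * ((f x).re * f'.re + (f x).im * f'.im)) x := by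
  convert h.norm_sq using 1
  simp [Complex.inner]
  ring

theorem HasDerivAt.complex_conj {f : ℝ → ℂ} {f' : ℂ} {x : ℝ} (h : HasDerivAt f f' x) :
    HasDerivAt (fun y => starRingEnd ℂ (f y)) (starRingEnd ℂ f') x :=
  Complex.conjCLE.toContinuousLinearMap.hasFDerivAt.comp_hasDerivAt x h

theorem hasDerivAt_fhat (M : ℝ) {r : ℝ} (hr : r ≠ 0) :
    HasDerivAt (fhat M) (5 * M / (3 * r ^ 2) - 4 * M ^ 2 / r ^ 3) r := by
  have h := (((hasDerivAt_id' r).sub_const (2 * M)).fun_mul ((hasDerivAt_id' r).sub_const (3 * M))).fun_div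
    ((hasDerivAt_pow 2 r).const_mul 3) (by positivity)
  refine h.congr_deriv ?_
  simp
  field_simp
  ring

theorem hasDerivAt_qhat (M : ℝ) {r : ℝ} (hr : r ≠ 0) :
    HasDerivAt (qhat M) (-1 / (3 * r ^ 2) + 7 * M / (3 * r ^ 3) - 3 * M ^ 2 / r ^ 4) r := by
  have h := ((((hasDerivAt_id' r).const_mul 2).sub_const (3 * M)).fun_mul
    ((hasDerivAt_id' r).fun_mul ((hasDerivAt_id' r).sub_const (2 * M)))).fun_div
    ((hasDerivAt_pow 4 r).const_mul 6) (by positivity)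
  refine h.congr_deriv ?_
  simp
  field_simp
  ring

theorem hasDerivAt_mul_sub (c r : ℝ) : HasDerivAt (fun x => x * (x - c)) (2 * r - c) r := by
  refine ((hasDerivAt_id' r).fun_mul ((hasDerivAt_id' r).sub_const c)).congr_deriv ?_
  simp
  ring

theorem deriv_delta_mul_qhat (M : ℝ) {r : ℝ} (hr : r ≠ 0) :
    deriv (fun y => y * (y - 2 * M) * qhat M y) r =
      1 / 3 - 10 * M ^ 2 / (3 * r ^ 2) + 4 * M ^ 3 / r ^ 3 := by
  rw [((hasDerivAt_mul_sub (2 * M) r).fun_mul (hasDerivAt_qhat M hr)).deriv, qhat]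
  field_simp
  ring

theorem hasDerivAt_deriv_delta_mul_qhat (M : ℝ) {r : ℝ} (hr : r ≠ 0) :
    HasDerivAt (fun x => deriv (fun y => y * (y - 2 * M) * qhat M y) x)
      (20 * M ^ 2 / (3 * r ^ 3) - 12 * M ^ 3 / r ^ 4) r := by
  have h := ((((hasDerivAt_pow 2 r).const_mul 3).inv (by positivity)).const_mul
    (-10 * M ^ 2)).fun_add (((hasDerivAt_pow 3 r).inv (pow_ne_zero 3 hr)).const_mul (4 * M ^ 3))
  refine ((h.const_add (1 / 3)).congr_of_eventuallyEq ?_).congr_deriv ?_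
  · filter_upwards [isOpen_ne.mem_nhds hr] with x hx
    rw [deriv_delta_mul_qhat M hx]
    simp
    ring
  · simp
    field_simp
    ring

theorem hasDerivAt_pow_four_div_delta (M : ℝ) {r : ℝ} (hr : r ≠ 0) (hr' : r - 2 * M ≠ 0) :
    HasDerivAt (fun x => x ^ 4 / (x * (x - 2 * M)))
      (2 * r ^ 2 * (r - 3 * M) / (r - 2 * M) ^ 2) r := by
  refine ((hasDerivAt_pow 4 r).fun_div (hasDerivAt_mul_sub (2 * M) r)
    (mul_ne_zero hr hr')).congr_deriv ?_
  simp
  field_simp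
  ring

theorem hasDerivAt_const_div (c : ℝ) {r : ℝ} (hr : r ≠ 0) :
    HasDerivAt (fun x => c / x) (-c / r ^ 2) r := by
  refine ((hasDerivAt_const r c).fun_div (hasDerivAt_id' r) hr).congr_deriv ?_
  simp

/-- Pointwise Morawetz multiplier identity for the separated Schwarzschild mode
equation with potential `V = −8M/r`. -/
theorem mode_morawetz_identity (M : ℝ) (hM : 0 < M) (Λ : ℝ)
    (φ G : ℝ → ℝ → ℂ)
    (hφ : ContDiffOn ℝ 2 (fun p : ℝ × ℝ => φ p.1 p.2)
      (Set.univ ×ˢ Set.Ioi (2 * M)))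
    (hG : ContinuousOn (fun p : ℝ × ℝ => G p.1 p.2)
      (Set.univ ×ˢ Set.Ioi (2 * M)))
    (heq : ∀ t : ℝ, ∀ r ∈ Set.Ioi (2 * M),
      ((r ^ 4 / (r * (r - 2 * M)) : ℝ) : ℂ)
          * deriv (fun s => deriv (fun s' => φ s' r) s) t
        - deriv (fun x => ((x * (x - 2 * M) : ℝ) : ℂ)
            * deriv (fun x' => φ t x') x) r
        + (Λ : ℂ) * φ t r - ((8 * M / r : ℝ) : ℂ) * φ t r + G t r = 0) :
    ∀ t : ℝ, ∀ r ∈ Set.Ioi (2 * M),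
      deriv (fun s =>
          (((r ^ 4 / (r * (r - 2 * M)) : ℝ) : ℂ) * Xmult M φ s r
            * starRingEnd ℂ (deriv (fun s' => φ s' r) s)).re) t
        + (1 / 2) * deriv (fun x => fhat M x *
            (Λ * ‖φ t x‖ ^ 2
              - x ^ 4 / (x * (x - 2 * M)) * ‖deriv (fun s => φ s x) t‖ ^ 2
              - x * (x - 2 * M) * ‖deriv (fun x' => φ t x') x‖ ^ 2
              - 8 * M / x * ‖φ t x‖ ^ 2)) r
        + (1 / 2) * deriv (fun x =>
            deriv (fun y => y * (y - 2 * M) * qhat M y) x * ‖φ t x‖ ^ 2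
            - 2 * (x * (x - 2 * M)) * qhat M x
                * (starRingEnd ℂ (φ t x) * deriv (fun x' => φ t x') x).re
            - 2 * qhat M x * (x - M) * ‖φ t x‖ ^ 2) r
        + M * (r * (r - 2 * M)) ^ 2 / r ^ 4 * ‖deriv (fun x => φ t x) r‖ ^ 2
        + (-(5 / 2) * M / r ^ 2 + 15 * M ^ 2 / r ^ 3 - 23 * M ^ 3 / r ^ 4)
            * ‖φ t r‖ ^ 2
        + (r - 3 * M) ^ 2 / (3 * r ^ 3) * (Λ * ‖φ t r‖ ^ 2)
      = -(Xmult M φ t r * starRingEnd ℂ (G t r)).re := by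
  intro t r hr
  have hr2 : 2 * M < r := hr
  have hr0 : r ≠ 0 := by linarith
  have hrM : r - 2 * M ≠ 0 := by linarith
  obtain ⟨A, B, C, ht, hx, htt, hxt, htx, hxx⟩ :=
    exists_hasDerivAt_partials (isOpen_univ.prod isOpen_Ioi) hφ
      (Set.mk_mem_prod (Set.mem_univ t) hr)
  have hΔ := hasDerivAt_mul_sub (2 * M) r
  have hf := hasDerivAt_fhat M hr0
  have hq := hasDerivAt_qhat M hr0
  have hE := heq t r hr
  rw [htt.deriv, (hΔ.ofReal_comp.fun_mul hxx).deriv] at hE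
  have hT := ((((hxt.const_mul (fhat M r : ℂ)).fun_add (ht.const_mul (qhat M r : ℂ))).const_mul
    ((r ^ 4 / (r * (r - 2 * M)) : ℝ) : ℂ)).fun_mul htt.complex_conj).complex_re
  have hR₁ := hf.fun_mul ((((hx.complex_norm_sq.const_mul Λ).fun_sub
    ((hasDerivAt_pow_four_div_delta M hr0 hrM).fun_mul htx.complex_norm_sq)).fun_sub
    (hΔ.fun_mul hxx.complex_norm_sq)).fun_sub
    ((hasDerivAt_const_div (8 * M) hr0).fun_mul hx.complex_norm_sq))
  have hR₂ := (((hasDerivAt_deriv_delta_mul_qhat M hr0).fun_mul hx.complex_norm_sq).fun_sub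
    (((hΔ.const_mul 2).fun_mul hq).fun_mul (hx.complex_conj.fun_mul hxx).complex_re)).fun_sub
    (((hq.const_mul 2).fun_mul ((hasDerivAt_id' r).sub_const M)).fun_mul hx.complex_norm_sq)
  simp only [Xmult]
  rw [hT.deriv, hR₁.deriv, hR₂.deriv, deriv_delta_mul_qhat M hr0]
  generalize deriv (fun s => φ s r) t = a at *
  generalize deriv (fun x => φ t x) r = b at *
  generalize φ t r = u at *
  generalize G t r = g at *
  have hre := congrArg Complex.re hE
  have him := congrArg Complex.im hE
  simp only [Complex.add_re, Complex.sub_re, Complex.mul_re, Complex.add_im, Complex.sub_im,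
    Complex.mul_im, Complex.ofReal_re, Complex.ofReal_im, Complex.conj_re, Complex.conj_im,
    Complex.zero_re, Complex.zero_im, Complex.sq_norm, Complex.normSq_apply] at hre him ⊢
  have hgr := eq_neg_of_add_eq_zero_right hre
  have hgi := eq_neg_of_add_eq_zero_right him
  rw [hgr, hgi, fhat, qhat]
  field_simp
  ring
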